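/- arXiv:2407.09655 — 2 statements merged into one kernel-verified Lean document; each statement's English description precedes it below -/
import Mathlib

section
/- For every x ∈ [N], the commutator of I ⊗ Γ with the single-input oracle unitary O^x satisfies ‖[I ⊗ Γ, O^x]‖ ≤ 6(ln N + 1)/N². -/
open scoped Classical
open Matrix

/-- Embedding of `Fin (k+1)` into `Fin N` (where `k : Fin N`). -/
def emb {N : ℕ} (k : Fin N) (t : Fin (k.val + 1)) : Fin N :=
  ⟨t.val, lt_of_lt_of_le t.isLt k.isLt⟩

/-- `Phi t = (N t_N)(N−1 t_{N−1})⋯(2 t_2)(1 t_1)`, the strictly monotone factorization map. -/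
def Phi {N : ℕ} (t : ∀ k : Fin N, Fin (k.val + 1)) : Equiv.Perm (Fin N) :=
  ((List.finRange N).reverse.map fun k => Equiv.swap k (emb k (t k))).prod

instance {N : ℕ} : Nonempty (∀ k : Fin N, Fin (k.val + 1)) := ⟨fun _ => 0⟩

/-- `tof π` is the tuple `(t_1(π),…,t_N(π))` of the strictly monotone factorization of `π`. -/
noncomputable def tof {N : ℕ} (π : Equiv.Perm (Fin N)) : ∀ k : Fin N, Fin (k.val + 1) :=
  Function.invFun Phi π

/-- `ptail π k` is `π_{>k} = (N t_N)⋯(k+1 t_{k+1})`. -/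
noncomputable def ptail {N : ℕ} (π : Equiv.Perm (Fin N)) (k : Fin N) : Equiv.Perm (Fin N) :=
  (((List.finRange N).reverse.filter fun j => decide (k < j)).map
    fun j => Equiv.swap j (emb j (tof π j))).prod

/-- `phead π k` is `π_{<k} = (k−1 t_{k−1})⋯(1 t_1)`. -/
noncomputable def phead {N : ℕ} (π : Equiv.Perm (Fin N)) (k : Fin N) : Equiv.Perm (Fin N) :=
  (((List.finRange N).reverse.filter fun j => decide (j < k)).map
    fun j => Equiv.swap j (emb j (tof π j))).prod

/-- The matrix of the unitary `L^τ` on `ℓ²(S_N)`, `L^τ|π⟩ = |τπ⟩`. -/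
noncomputable def Lmat {N : ℕ} (τ : Equiv.Perm (Fin N)) :
    Matrix (Equiv.Perm (Fin N)) (Equiv.Perm (Fin N)) ℂ := fun ρ π =>
  if ρ = τ * π then 1 else 0

/-- The matrix of the unitary `R^σ` on `ℓ²(S_N)`, `R^σ|π⟩ = |πσ⁻¹⟩`. -/
noncomputable def Rmat {N : ℕ} (σ : Equiv.Perm (Fin N)) :
    Matrix (Equiv.Perm (Fin N)) (Equiv.Perm (Fin N)) ℂ := fun ρ π =>
  if ρ = π * σ⁻¹ then 1 else 0

/-- The matrix of the orthogonal projection `P_x` on `ℓ²(S_N)`, determined by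
`P_x|π⟩ = (1/x) ∑_{s=1}^{x} |π_{>x} (x s) π_{<x}⟩`. -/
noncomputable def PxPerm {N : ℕ} (x : Fin N) :
    Matrix (Equiv.Perm (Fin N)) (Equiv.Perm (Fin N)) ℂ := fun ρ π =>
  if ∃ s : Fin (x.val + 1), ρ = ptail π x * Equiv.swap x (emb x s) * phead π x then
    ((x.val : ℂ) + 1)⁻¹
  else 0

/-- `W^{(ℓ)}`, the average of `R^γ` over all `ℓ`-cycles `γ ∈ S_N`. -/
noncomputable def Wmat {N : ℕ} (l : ℕ) :
    Matrix (Equiv.Perm (Fin N)) (Equiv.Perm (Fin N)) ℂ :=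
  (((Finset.univ.filter fun γ : Equiv.Perm (Fin N) =>
        γ.IsCycle ∧ γ.support.card = l).card : ℂ))⁻¹ •
    ∑ γ ∈ Finset.univ.filter
        (fun γ : Equiv.Perm (Fin N) => γ.IsCycle ∧ γ.support.card = l),
      Rmat γ

/-- The twirled operator
`Γ = (1/N) ∑_{x=1}^{N} (1/x) · (1/(N!)²) ∑_{σ,τ} (L^τ R^σ)† (I − P_x) (L^τ R^σ)` on `ℓ²(S_N)`. -/
noncomputable def GammaM {N : ℕ} :
    Matrix (Equiv.Perm (Fin N)) (Equiv.Perm (Fin N)) ℂ :=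
  (N : ℂ)⁻¹ • ∑ x : Fin N, ((x.val : ℂ) + 1)⁻¹ •
    ((((N.factorial : ℂ)) ^ 2)⁻¹ •
      ∑ σ : Equiv.Perm (Fin N), ∑ τ : Equiv.Perm (Fin N),
        (Lmat τ * Rmat σ)ᴴ *
          ((1 : Matrix (Equiv.Perm (Fin N)) (Equiv.Perm (Fin N)) ℂ) - PxPerm x) *
          (Lmat τ * Rmat σ))

/-- The bounded operator on `ℓ²(ι)` (Euclidean space) associated with a matrix. -/
noncomputable def toCLM {ι : Type*} [Fintype ι] [DecidableEq ι] (M : Matrix ι ι ℂ) :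
    EuclideanSpace ℂ ι →L[ℂ] EuclideanSpace ℂ ι :=
  LinearMap.toContinuousLinearMap (Matrix.toEuclideanLin M)

/-- Bitwise XOR on `Fin (2^n)`, coming from the identification of `[N] = [2^n]`
with `{0,1}^n` via binary expansion. -/
def xorFin {n : ℕ} (a b : Fin (2 ^ n)) : Fin (2 ^ n) :=
  ⟨a.val ^^^ b.val, Nat.xor_lt_two_pow a.isLt b.isLt⟩

/-- The matrix of the unitary `O^x` on `ℂ^N ⊗ ℓ²(S_N)` determined by
`O^x (|y⟩ ⊗ |π⟩) = |y ⊕ π(x)⟩ ⊗ |π⟩` (with `N = 2^n`). -/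
noncomputable def OxM {n : ℕ} (x : Fin (2 ^ n)) :
    Matrix (Fin (2 ^ n) × Equiv.Perm (Fin (2 ^ n))) (Fin (2 ^ n) × Equiv.Perm (Fin (2 ^ n))) ℂ :=
  fun p q => if p.2 = q.2 ∧ p.1 = xorFin q.1 (q.2 x) then 1 else 0

/-! ### The strictly monotone factorization -/

/-- A permutation supported on a strictly decreasing list `l` is a product of transpositions
`(k t_k)` with `t_k ≤ k`, taken in the order of `l`. -/
theorem exists_prod_swap_emb_eq {N : ℕ} (l : List (Fin N)) (hl : l.Pairwise (· > ·))
    (π : Equiv.Perm (Fin N)) (hπ : ∀ j, π j ≠ j → j ∈ l) :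
    ∃ t : ∀ k : Fin N, Fin (k.val + 1),
      (l.map fun k => Equiv.swap k (emb k (t k))).prod = π := by
  induction l generalizing π with
  | nil =>
    refine ⟨fun _ => 0, ?_⟩
    ext j
    have : π j = j := by
      by_contra h
      simpa using hπ j h
    simp [this]
  | cons k l ih =>
    rw [List.pairwise_cons] at hl
    have hle : (π k).val < k.val + 1 := by
      by_cases h : π k = k
      · simp [h]
      · have h2 : π k ∈ k :: l := hπ _ (fun h3 => h (π.injective h3))
        rcases List.mem_cons.1 h2 with h3 | h3
        · exact absurd h3 h
        · have := hl.1 _ h3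
          simp only [gt_iff_lt, Fin.lt_def] at this
          omega
    obtain ⟨t, ht⟩ := ih hl.2 (Equiv.swap k (π k) * π) (by
      intro j hj
      have hjk : j ≠ k := by
        rintro rfl
        simp at hj
      have hπj : π j ≠ j := by
        intro h
        rw [Equiv.Perm.mul_apply, h] at hj
        by_cases h2 : j = π k
        · exact hjk (π.injective (h.trans h2))
        · exact hj (Equiv.swap_apply_of_ne_of_ne hjk h2)
      exact (List.mem_cons.1 (hπ j hπj)).resolve_left hjk)
    refine ⟨Function.update t k ⟨(π k).val, hle⟩, ?_⟩
    have hmap : l.map (fun j => Equiv.swap j (emb j (Function.update t k ⟨(π k).val, hle⟩ j)))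
        = l.map fun j => Equiv.swap j (emb j (t j)) := by
      refine List.map_congr_left fun j hj => ?_
      have hjk : j ≠ k := (hl.1 j hj).ne
      rw [Function.update_of_ne hjk]
    rw [List.map_cons, List.prod_cons, hmap, ht]
    simp only [Function.update_self]
    have : emb k ⟨(π k).val, hle⟩ = π k := rfl
    rw [this, Equiv.swap_mul_self_mul]

theorem pairwise_gt_finRange_reverse (N : ℕ) : (List.finRange N).reverse.Pairwise (· > ·) := by
  rw [List.pairwise_reverse]
  exact List.pairwise_lt_finRange N

theorem Phi_surjective {N : ℕ} : Function.Surjective (Phi (N := N)) := fun π =>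
  exists_prod_swap_emb_eq _ (pairwise_gt_finRange_reverse N) π (by simp)

theorem Phi_tof {N : ℕ} (π : Equiv.Perm (Fin N)) : Phi (tof π) = π :=
  Function.invFun_eq (Phi_surjective π)

theorem eq_filter_append_cons_filter_of_pairwise_gt {α : Type*} [LinearOrder α] {l : List α}
    (hl : l.Pairwise (· > ·)) {k : α} (hk : k ∈ l) :
    l = l.filter (fun j => decide (k < j)) ++ k :: l.filter (fun j => decide (j < k)) := by
  induction l with
  | nil => simp at hk
  | cons a l ih =>
    rw [List.pairwise_cons] at hl
    rcases List.mem_cons.1 hk with rfl | h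
    · have h1 : l.filter (fun j => decide (k < j)) = [] := by
        rw [List.filter_eq_nil_iff]
        intro j hj
        simpa using (hl.1 j hj).le
      have h2 : l.filter (fun j => decide (j < k)) = l := by
        rw [List.filter_eq_self]
        intro j hj
        simpa using hl.1 j hj
      simp [h1, h2]
    · have hak := hl.1 k h
      have h1 := ih hl.2 h
      rw [List.filter_cons_of_pos (by simpa using hak),
        List.filter_cons_of_neg (by simpa using hak.le), List.cons_append, ← h1]

theorem ptail_mul_swap_mul_phead {N : ℕ} (π : Equiv.Perm (Fin N)) (k : Fin N) :
    ptail π k * Equiv.swap k (emb k (tof π k)) * phead π k = π := by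
  conv_rhs => rw [← Phi_tof π]
  rw [Phi, eq_filter_append_cons_filter_of_pairwise_gt (pairwise_gt_finRange_reverse N)
    (k := k) (by simp)]
  simp only [ptail, phead, List.map_append, List.prod_append, List.map_cons, List.prod_cons,
    mul_assoc]

/-! ### The matrix entries of `P_x` -/

theorem card_support_inv_mul_le_three {N : ℕ} {k : Fin N} {ρ π : Equiv.Perm (Fin N)}
    {s : Fin (k.val + 1)} (h : ρ = ptail π k * Equiv.swap k (emb k s) * phead π k) :
    (π⁻¹ * ρ).support.card ≤ 3 := by
  set t := emb k (tof π k)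
  have h1 : π⁻¹ * ρ = (phead π k)⁻¹ * (Equiv.swap k t * Equiv.swap k (emb k s)) *
      ((phead π k)⁻¹)⁻¹ := by
    have hπ : π⁻¹ = (phead π k)⁻¹ * Equiv.swap k t * (ptail π k)⁻¹ := by
      conv_lhs => rw [← ptail_mul_swap_mul_phead π k]
      rw [_root_.mul_inv_rev, _root_.mul_inv_rev, Equiv.swap_inv, mul_assoc]
    rw [h, hπ]
    group
  rw [h1, Equiv.Perm.card_support_conj]
  refine (Finset.card_le_card (t := {k, t, emb k s}) ?_).trans Finset.card_le_three
  intro j hj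
  by_contra hne
  simp only [Finset.mem_insert, Finset.mem_singleton, not_or] at hne
  rw [Equiv.Perm.mem_support, Equiv.Perm.mul_apply,
    Equiv.swap_apply_of_ne_of_ne hne.1 hne.2.2, Equiv.swap_apply_of_ne_of_ne hne.1 hne.2.1] at hj
  exact hj rfl

/-- The real entries of the matrix of `P_x`. -/
noncomputable def jumpProb {N : ℕ} (k : Fin N) (ρ π : Equiv.Perm (Fin N)) : ℝ :=
  if ∃ s : Fin (k.val + 1), ρ = ptail π k * Equiv.swap k (emb k s) * phead π k then
    ((k.val : ℝ) + 1)⁻¹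
  else 0

theorem PxPerm_apply {N : ℕ} (k : Fin N) (ρ π : Equiv.Perm (Fin N)) :
    PxPerm k ρ π = (jumpProb k ρ π : ℂ) := by
  unfold PxPerm jumpProb
  split_ifs
  · simp
  · simp

theorem jumpProb_nonneg {N : ℕ} (k : Fin N) (ρ π : Equiv.Perm (Fin N)) : 0 ≤ jumpProb k ρ π := by
  unfold jumpProb
  split_ifs <;> positivity

theorem card_support_le_of_jumpProb_ne_zero {N : ℕ} {k : Fin N} {ρ π : Equiv.Perm (Fin N)}
    (h : jumpProb k ρ π ≠ 0) : (π⁻¹ * ρ).support.card ≤ 3 := by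
  unfold jumpProb at h
  split_ifs at h with hs
  · obtain ⟨s, hs⟩ := hs
    exact card_support_inv_mul_le_three hs
  · exact absurd rfl h

theorem sum_jumpProb_le_one {N : ℕ} (k : Fin N) (π : Equiv.Perm (Fin N)) :
    ∑ ρ, jumpProb k ρ π ≤ 1 := by
  unfold jumpProb
  rw [← Finset.sum_filter, Finset.sum_const, nsmul_eq_mul]
  have hsub : (Finset.univ.filter fun ρ : Equiv.Perm (Fin N) =>
      ∃ s : Fin (k.val + 1), ρ = ptail π k * Equiv.swap k (emb k s) * phead π k) ⊆
      Finset.univ.image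
        fun s : Fin (k.val + 1) => ptail π k * Equiv.swap k (emb k s) * phead π k := by
    intro ρ hρ
    obtain ⟨s, hs⟩ := (Finset.mem_filter.1 hρ).2
    exact Finset.mem_image.2 ⟨s, Finset.mem_univ _, hs.symm⟩
  have hcard := (Finset.card_le_card hsub).trans Finset.card_image_le
  rw [Finset.card_univ, Fintype.card_fin] at hcard
  rw [← div_eq_mul_inv, div_le_one (by positivity)]
  exact_mod_cast hcard

/-! ### Twirling -/

/-- The coefficient of `R^g` in the twirl of `P_x`. -/
noncomputable def twirlWeight {N : ℕ} (k : Fin N) (g : Equiv.Perm (Fin N)) : ℝ :=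
  ((N.factorial : ℝ) ^ 2)⁻¹ * ∑ σ : Equiv.Perm (Fin N), ∑ τ : Equiv.Perm (Fin N),
    jumpProb k (τ * g⁻¹ * σ⁻¹) (τ * σ⁻¹)

theorem twirlWeight_nonneg {N : ℕ} (k : Fin N) (g : Equiv.Perm (Fin N)) : 0 ≤ twirlWeight k g :=
  mul_nonneg (by positivity)
    (Finset.sum_nonneg fun _ _ => Finset.sum_nonneg fun _ _ => jumpProb_nonneg _ _ _)

theorem twirlWeight_conj {N : ℕ} (k : Fin N) (h g : Equiv.Perm (Fin N)) :
    twirlWeight k (h * g * h⁻¹) = twirlWeight k g := by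
  unfold twirlWeight
  congr 1
  refine Fintype.sum_equiv (Equiv.mulRight h) _ _ fun σ => ?_
  refine Fintype.sum_equiv (Equiv.mulRight h) _ _ fun τ => ?_
  simp only [Equiv.coe_mulRight]
  congr 1
  group

theorem sum_twirlWeight_mul_card_support_le {N : ℕ} (k : Fin N) :
    ∑ g, twirlWeight k g * (g.support.card : ℝ) ≤ 3 := by
  have key : ∀ σ τ : Equiv.Perm (Fin N),
      ∑ g : Equiv.Perm (Fin N), jumpProb k (τ * g⁻¹ * σ⁻¹) (τ * σ⁻¹) * (g.support.card : ℝ) ≤ 3 := by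
    intro σ τ
    calc ∑ g : Equiv.Perm (Fin N), jumpProb k (τ * g⁻¹ * σ⁻¹) (τ * σ⁻¹) * (g.support.card : ℝ)
        ≤ ∑ g : Equiv.Perm (Fin N), jumpProb k (τ * g⁻¹ * σ⁻¹) (τ * σ⁻¹) * 3 := by
          refine Finset.sum_le_sum fun g _ => ?_
          by_cases h0 : jumpProb k (τ * g⁻¹ * σ⁻¹) (τ * σ⁻¹) = 0
          · simp [h0]
          · have h1 := card_support_le_of_jumpProb_ne_zero h0
            have h2 : (τ * σ⁻¹)⁻¹ * (τ * g⁻¹ * σ⁻¹) = σ * g⁻¹ * σ⁻¹ := by group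
            rw [h2, Equiv.Perm.card_support_conj, Equiv.Perm.support_inv] at h1
            exact mul_le_mul_of_nonneg_left (by exact_mod_cast h1) (jumpProb_nonneg _ _ _)
      _ = (∑ ρ, jumpProb k ρ (τ * σ⁻¹)) * 3 := by
          rw [← Finset.sum_mul]
          congr 1
          exact Fintype.sum_equiv
            ((Equiv.inv _).trans ((Equiv.mulLeft τ).trans (Equiv.mulRight σ⁻¹))) _ _ fun g => rfl
      _ ≤ 3 := by linarith [sum_jumpProb_le_one k (τ * σ⁻¹)]
  have hswap : ∑ g, twirlWeight k g * (g.support.card : ℝ) =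
      ((N.factorial : ℝ) ^ 2)⁻¹ * ∑ σ : Equiv.Perm (Fin N), ∑ τ : Equiv.Perm (Fin N),
        ∑ g : Equiv.Perm (Fin N),
          jumpProb k (τ * g⁻¹ * σ⁻¹) (τ * σ⁻¹) * (g.support.card : ℝ) := by
    simp only [twirlWeight, mul_assoc, ← Finset.mul_sum, Finset.sum_mul]
    congr 1
    rw [Finset.sum_comm]
    exact Finset.sum_congr rfl fun σ _ => Finset.sum_comm
  rw [hswap, inv_mul_le_iff₀ (by positivity)]
  calc _ ≤ ∑ σ : Equiv.Perm (Fin N), ∑ τ : Equiv.Perm (Fin N), (3 : ℝ) :=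
        Finset.sum_le_sum fun σ _ => Finset.sum_le_sum fun τ _ => key σ τ
    _ = (N.factorial : ℝ) ^ 2 * 3 := by
        simp [Fintype.card_perm]
        ring

theorem sum_twirlWeight_moving_le {N : ℕ} (k x : Fin N) :
    ∑ g : Equiv.Perm (Fin N), twirlWeight k g * (if g x = x then 0 else 1) ≤ 3 / N := by
  have hN : 0 < (N : ℝ) := by exact_mod_cast x.pos
  have heq : ∀ y : Fin N, ∑ g : Equiv.Perm (Fin N), twirlWeight k g * (if g y = y then 0 else 1) =
      ∑ g : Equiv.Perm (Fin N), twirlWeight k g * (if g x = x then 0 else 1) := by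
    intro y
    refine Fintype.sum_equiv (MulAut.conj (Equiv.swap x y)).toEquiv _ _ fun g => ?_
    have h : (Equiv.swap x y * g * (Equiv.swap x y)⁻¹) x = x ↔ g y = y := by
      simp [Equiv.swap_apply_eq_iff]
    simp only [MulEquiv.toEquiv_eq_coe, MulEquiv.coe_toEquiv, MulAut.conj_apply,
      twirlWeight_conj, h]
  have hsum : ∑ y : Fin N, ∑ g : Equiv.Perm (Fin N),
      twirlWeight k g * (if g y = y then 0 else 1) =
      ∑ g, twirlWeight k g * (g.support.card : ℝ) := by
    rw [Finset.sum_comm]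
    refine Finset.sum_congr rfl fun g _ => ?_
    rw [← Finset.mul_sum, Equiv.Perm.support, Finset.card_filter]
    push_cast
    simp
  rw [Finset.sum_congr rfl fun y _ => heq y, Finset.sum_const, Finset.card_univ,
    Fintype.card_fin, nsmul_eq_mul] at hsum
  rw [le_div_iff₀ hN, mul_comm, hsum]
  exact sum_twirlWeight_mul_card_support_le k

theorem Rmat_eq_permMatrix {N : ℕ} (σ : Equiv.Perm (Fin N)) :
    Rmat σ = Equiv.Perm.permMatrix ℂ (Equiv.mulRight σ : Equiv.Perm (Equiv.Perm (Fin N))) := by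
  ext ρ π
  simp [Rmat, PEquiv.toMatrix_apply, eq_mul_inv_iff_mul_eq, eq_comm]

theorem Lmat_eq_permMatrix {N : ℕ} (τ : Equiv.Perm (Fin N)) :
    Lmat τ = Equiv.Perm.permMatrix ℂ (Equiv.mulLeft τ⁻¹ : Equiv.Perm (Equiv.Perm (Fin N))) := by
  ext ρ π
  simp [Lmat, PEquiv.toMatrix_apply, inv_mul_eq_iff_eq_mul]

theorem conj_Lmat_mul_Rmat_apply {N : ℕ} (σ τ : Equiv.Perm (Fin N))
    (M : Matrix (Equiv.Perm (Fin N)) (Equiv.Perm (Fin N)) ℂ) (ρ π : Equiv.Perm (Fin N)) :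
    ((Lmat τ * Rmat σ)ᴴ * M * (Lmat τ * Rmat σ)) ρ π = M (τ * ρ * σ⁻¹) (τ * π * σ⁻¹) := by
  rw [Lmat_eq_permMatrix, Rmat_eq_permMatrix, ← permMatrix_mul, conjTranspose_permMatrix,
    PEquiv.toMatrix_toPEquiv_mul, PEquiv.mul_toMatrix_toPEquiv]
  simp [Equiv.Perm.mul_def, Equiv.trans_assoc]

theorem twirl_eq {N : ℕ} (k : Fin N) :
    (((N.factorial : ℂ)) ^ 2)⁻¹ •
      ∑ σ : Equiv.Perm (Fin N), ∑ τ : Equiv.Perm (Fin N),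
        (Lmat τ * Rmat σ)ᴴ *
          ((1 : Matrix (Equiv.Perm (Fin N)) (Equiv.Perm (Fin N)) ℂ) - PxPerm k) *
          (Lmat τ * Rmat σ)
      = 1 - ∑ g, (twirlWeight k g : ℂ) • Rmat g := by
  have hN : (N.factorial : ℂ) ≠ 0 := by exact_mod_cast N.factorial_ne_zero
  ext ρ π
  have hR : (∑ g, (twirlWeight k g : ℂ) • Rmat g) ρ π = twirlWeight k (ρ⁻¹ * π) := by
    rw [Matrix.sum_apply, Finset.sum_eq_single (ρ⁻¹ * π)]
    · simp [Rmat]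
    · intro g _ hg
      have : ρ ≠ π * g⁻¹ := by
        rintro rfl
        exact hg (by group)
      simp [Rmat, this]
    · simp
  have hw : (twirlWeight k (ρ⁻¹ * π) : ℂ) = ((N.factorial : ℂ) ^ 2)⁻¹ *
      ∑ σ : Equiv.Perm (Fin N), ∑ τ : Equiv.Perm (Fin N),
        PxPerm k (τ * ρ * σ⁻¹) (τ * π * σ⁻¹) := by
    simp only [twirlWeight, PxPerm_apply]
    push_cast
    congr 1
    refine Finset.sum_congr rfl fun σ _ => ?_
    refine Fintype.sum_equiv (Equiv.mulRight π⁻¹) _ _ fun τ => ?_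
    simp [mul_assoc]
  rw [Matrix.sub_apply, hR, hw, Matrix.smul_apply, Matrix.sum_apply]
  simp only [Matrix.sum_apply, conj_Lmat_mul_Rmat_apply, Matrix.sub_apply,
    Finset.sum_sub_distrib, smul_eq_mul]
  rw [mul_sub]
  congr 1
  have : ∀ σ τ : Equiv.Perm (Fin N),
      (1 : Matrix (Equiv.Perm (Fin N)) (Equiv.Perm (Fin N)) ℂ) (τ * ρ * σ⁻¹) (τ * π * σ⁻¹) =
        (1 : Matrix (Equiv.Perm (Fin N)) (Equiv.Perm (Fin N)) ℂ) ρ π := by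
    intro σ τ
    simp [Matrix.one_apply]
  simp only [this, Finset.sum_const, Finset.card_univ, Fintype.card_perm, Fintype.card_fin,
    nsmul_eq_mul]
  field_simp

theorem GammaM_eq {N : ℕ} :
    GammaM (N := N) = (N : ℂ)⁻¹ • ∑ k : Fin N, ((k.val : ℂ) + 1)⁻¹ •
      (1 - ∑ g, (twirlWeight k g : ℂ) • Rmat g) := by
  unfold GammaM
  simp only [twirl_eq]

/-! ### Commutators with the oracle -/

open scoped Matrix.Norms.L2Operator

theorem norm_toCLM {ι : Type*} [Fintype ι] [DecidableEq ι] (M : Matrix ι ι ℂ) :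
    ‖toCLM M‖ = ‖M‖ := rfl

theorem xorFin_xorFin {n : ℕ} (a b : Fin (2 ^ n)) : xorFin (xorFin a b) b = a := by
  ext
  simp [xorFin]

/-- The permutation of basis vectors underlying `O^x`. -/
def oraclePerm {n : ℕ} (x : Fin (2 ^ n)) :
    Equiv.Perm (Fin (2 ^ n) × Equiv.Perm (Fin (2 ^ n))) where
  toFun p := (xorFin p.1 (p.2 x), p.2)
  invFun p := (xorFin p.1 (p.2 x), p.2)
  left_inv p := by simp [xorFin_xorFin]
  right_inv p := by simp [xorFin_xorFin]

theorem OxM_eq_permMatrix {n : ℕ} (x : Fin (2 ^ n)) :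
    OxM x = Equiv.Perm.permMatrix ℂ (oraclePerm x) := by
  ext p q
  obtain ⟨y, π⟩ := p
  obtain ⟨z, ρ⟩ := q
  have : (π = ρ ∧ y = xorFin z (ρ x)) ↔ xorFin y (π x) = z ∧ π = ρ := by
    constructor
    · rintro ⟨rfl, rfl⟩
      exact ⟨xorFin_xorFin _ _, rfl⟩
    · rintro ⟨rfl, rfl⟩
      exact ⟨rfl, (xorFin_xorFin _ _).symm⟩
  simp [OxM, PEquiv.toMatrix_apply, oraclePerm, this, eq_comm]

open scoped Kronecker

theorem one_kronecker_Rmat_eq_permMatrix {N : ℕ} (g : Equiv.Perm (Fin N)) :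
    (1 : Matrix (Fin N) (Fin N) ℂ) ⊗ₖ Rmat g =
      Equiv.Perm.permMatrix ℂ (Equiv.prodCongr (Equiv.refl (Fin N)) (Equiv.mulRight g)) := by
  rw [Rmat_eq_permMatrix]
  ext p q
  obtain ⟨y, π⟩ := p
  obtain ⟨z, ρ⟩ := q
  simp [PEquiv.toMatrix_apply, Matrix.one_apply, ← ite_and, and_comm, eq_comm]

/-- The commutator `[I ⊗ M, O^x]`, as a linear function of `M`. -/
noncomputable def oracleCommutator {n : ℕ} (x : Fin (2 ^ n)) :
    Matrix (Equiv.Perm (Fin (2 ^ n))) (Equiv.Perm (Fin (2 ^ n))) ℂ →ₗ[ℂ]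
      Matrix (Fin (2 ^ n) × Equiv.Perm (Fin (2 ^ n)))
        (Fin (2 ^ n) × Equiv.Perm (Fin (2 ^ n))) ℂ where
  toFun M := ((1 : Matrix (Fin (2 ^ n)) (Fin (2 ^ n)) ℂ) ⊗ₖ M) * OxM x
    - OxM x * ((1 : Matrix (Fin (2 ^ n)) (Fin (2 ^ n)) ℂ) ⊗ₖ M)
  map_add' A B := by
    rw [Matrix.kronecker_add, add_mul, mul_add]
    abel
  map_smul' c A := by
    simp [Matrix.kronecker_smul, smul_sub]

theorem oracleCommutator_one {n : ℕ} (x : Fin (2 ^ n)) : oracleCommutator x 1 = 0 := by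
  simp [oracleCommutator]

theorem norm_oracleCommutator_Rmat_le {n : ℕ} (x : Fin (2 ^ n)) (g : Equiv.Perm (Fin (2 ^ n))) :
    ‖oracleCommutator x (Rmat g)‖ ≤ 2 * (if g x = x then 0 else 1) := by
  simp only [oracleCommutator, LinearMap.coe_mk, AddHom.coe_mk]
  rw [one_kronecker_Rmat_eq_permMatrix, OxM_eq_permMatrix, ← permMatrix_mul, ← permMatrix_mul]
  split_ifs with h
  · rw [mul_zero, norm_le_zero_iff, sub_eq_zero]
    congr 1
    ext p : 1
    simp [oraclePerm, h]
  · refine (norm_sub_le _ _).trans ?_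
    linarith [permMatrix_l2_opNorm_le (𝕜 := ℂ)
        (oraclePerm x * Equiv.prodCongr (Equiv.refl (Fin (2 ^ n))) (Equiv.mulRight g)),
      permMatrix_l2_opNorm_le (𝕜 := ℂ)
        (Equiv.prodCongr (Equiv.refl (Fin (2 ^ n))) (Equiv.mulRight g) * oraclePerm x)]

theorem norm_oracleCommutator_twirl_le {n : ℕ} (x k : Fin (2 ^ n)) :
    ‖oracleCommutator x (1 - ∑ g, (twirlWeight k g : ℂ) • Rmat g)‖ ≤ 6 / (2 : ℝ) ^ n := by
  rw [map_sub, oracleCommutator_one, zero_sub, norm_neg, map_sum]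
  simp only [map_smul]
  calc _ ≤ ∑ g : Equiv.Perm (Fin (2 ^ n)), twirlWeight k g * (2 * (if g x = x then 0 else 1)) := by
        refine norm_sum_le_of_le _ fun g _ => ?_
        rw [norm_smul, Complex.norm_real, Real.norm_of_nonneg (twirlWeight_nonneg k g)]
        exact mul_le_mul_of_nonneg_left (norm_oracleCommutator_Rmat_le x g)
          (twirlWeight_nonneg k g)
    _ = 2 * ∑ g : Equiv.Perm (Fin (2 ^ n)), twirlWeight k g * (if g x = x then 0 else 1) := by
        rw [Finset.mul_sum]
        exact Finset.sum_congr rfl fun g _ => by ring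
    _ ≤ 2 * (3 / (2 ^ n : ℕ)) :=
        mul_le_mul_of_nonneg_left (sum_twirlWeight_moving_le k x) (by norm_num)
    _ = 6 / (2 : ℝ) ^ n := by
        push_cast
        ring

theorem sum_inv_succ_le_one_add_log (N : ℕ) :
    ∑ k : Fin N, ((k.val : ℝ) + 1)⁻¹ ≤ 1 + Real.log N := by
  have h := harmonic_le_one_add_log N
  rw [harmonic] at h
  push_cast at h
  rwa [Fin.sum_univ_eq_sum_range fun k => ((k : ℝ) + 1)⁻¹]

open scoped Kronecker in
/-- For every `x ∈ [N]` (`N = 2^n`), the commutator of `I ⊗ Γ` with the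
single-input oracle unitary `O^x` satisfies `‖[I ⊗ Γ, O^x]‖ ≤ 6(ln N + 1)/N²`. -/
theorem stmt15 {n : ℕ} (hn : 2 ≤ n) (x : Fin (2 ^ n)) :
    ‖toCLM (((1 : Matrix (Fin (2 ^ n)) (Fin (2 ^ n)) ℂ) ⊗ₖ GammaM (N := 2 ^ n)) * OxM x
        - OxM x * ((1 : Matrix (Fin (2 ^ n)) (Fin (2 ^ n)) ℂ) ⊗ₖ GammaM (N := 2 ^ n)))‖
      ≤ 6 * (Real.log ((2 : ℝ) ^ n) + 1) / ((2 : ℝ) ^ n) ^ 2 := by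
  have hnorm : ‖oracleCommutator x (GammaM (N := 2 ^ n))‖ ≤
      6 * (Real.log ((2 : ℝ) ^ n) + 1) / ((2 : ℝ) ^ n) ^ 2 := by
    rw [GammaM_eq, map_smul, map_sum, norm_smul]
    simp only [map_smul]
    calc _ ≤ ((2 : ℝ) ^ n)⁻¹ *
          ∑ k : Fin (2 ^ n), ((k.val : ℝ) + 1)⁻¹ * (6 / (2 : ℝ) ^ n) := by
          refine mul_le_mul (by simp) (norm_sum_le_of_le _ fun k _ => ?_) (norm_nonneg _)
            (by positivity)
          rw [norm_smul]
          have hk : ‖((k.val : ℂ) + 1)⁻¹‖ = ((k.val : ℝ) + 1)⁻¹ := by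
            rw [norm_inv]
            exact_mod_cast congrArg Inv.inv (Complex.norm_natCast (k.val + 1))
          rw [hk]
          exact mul_le_mul_of_nonneg_left (norm_oracleCommutator_twirl_le x k) (by positivity)
      _ = (∑ k : Fin (2 ^ n), ((k.val : ℝ) + 1)⁻¹) * (6 / ((2 : ℝ) ^ n) ^ 2) := by
          rw [← Finset.sum_mul]
          field_simp
      _ ≤ (1 + Real.log ((2 : ℝ) ^ n)) * (6 / ((2 : ℝ) ^ n) ^ 2) := by
          refine mul_le_mul_of_nonneg_right ?_ (by positivity)
          exact_mod_cast sum_inv_succ_le_one_add_log (2 ^ n)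
      _ = 6 * (Real.log ((2 : ℝ) ^ n) + 1) / ((2 : ℝ) ^ n) ^ 2 := by ring
  exact hnorm
end

section
/- Let c ∈ {1,…,n−1} and, for π ∈ S_{2^n}, let f_π : {0,1}^{n−c} → {0,1}^{n−c} be the one-round sponge function f_π(x) = π(x‖0^c)_{[1,n−c]} (the first n−c bits of π applied to x padded with c zeros). Fix a target y ∈ {0,1}^{n−c}. For every q ≥ 1 and every quantum query algorithm making fewer than q queries and outputting x ∈ {0,1}^{n−c} (the first n−c bits of the measured X register), the average preimage-finding probability satisfies (1/N!) ∑_{π ∈ S_N} ∑_{x ∈ {0,1}^{n−c} : f_π(x) = y} Pr_π[x] ≤ 914 · q³ · (n + 2) / 2^{min(c, n−c)}, where N = 2^n. -/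
open scoped Classical Kronecker

/-- Bitwise XOR on bit strings `{0,1}^m`. -/
def bxor {m : ℕ} (a b : Fin m → Bool) : Fin m → Bool := fun i => xor (a i) (b i)

/-- The matrix of the oracle unitary `U^π` on `ℂ^N ⊗ ℂ^N` (with basis `{0,1}^m`),
determined by `U^π|x,y⟩ = |x, y ⊕ π(x)⟩`. -/
noncomputable def oracleM {m : ℕ} (π : Equiv.Perm (Fin m → Bool)) :
    Matrix ((Fin m → Bool) × (Fin m → Bool)) ((Fin m → Bool) × (Fin m → Bool)) ℂ :=
  fun p q => if p.1 = q.1 ∧ p.2 = bxor q.2 (π q.1) then 1 else 0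

/-- A quantum query algorithm making `q'` queries to a permutation of `{0,1}^m` and its
inverse: a finite workspace register `W` with a distinguished element `w0`, unitaries
`U⁽⁰⁾, …, U^{(q')}` on `ℂ^W ⊗ ℂ^N ⊗ ℂ^N`, and for each query a direction (forward or
inverse). -/
structure QueryAlg (m : ℕ) (q' : ℕ) where
  /-- the workspace index set -/
  W : Type
  [fW : Fintype W]
  [dW : DecidableEq W]
  /-- the distinguished initial workspace basis element -/
  w0 : W
  /-- the oracle-independent unitaries -/
  U : Fin (q' + 1) → Matrix (W × (Fin m → Bool) × (Fin m → Bool))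
      (W × (Fin m → Bool) × (Fin m → Bool)) ℂ
  unitary : ∀ j, U j ∈ Matrix.unitaryGroup (W × (Fin m → Bool) × (Fin m → Bool)) ℂ
  /-- direction of each query: `true` = forward, `false` = inverse -/
  fwd : Fin q' → Bool

attribute [instance] QueryAlg.fW QueryAlg.dW

/-- The final state `|ψ_π⟩ = U^{(q')} (I_W ⊗ O_{q'}) ⋯ (I_W ⊗ O_1) U⁽⁰⁾ |w0, 0, 0⟩`,
where `O_j = U^π` for a forward query and `O_j = U^{π⁻¹}` for an inverse query. -/
noncomputable def finalState {m q' : ℕ} (A : QueryAlg m q') (π : Equiv.Perm (Fin m → Bool)) :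
    A.W × (Fin m → Bool) × (Fin m → Bool) → ℂ :=
  (((List.ofFn fun j : Fin q' =>
        A.U j.succ *
          ((1 : Matrix A.W A.W ℂ) ⊗ₖ oracleM (if A.fwd j then π else π⁻¹))).reverse.prod
      * A.U 0).mulVec
    fun p => if p = (A.w0, fun _ => false, fun _ => false) then 1 else 0)

/-- `x ‖ z`: concatenation of `x ∈ {0,1}^{n−c}` with `z ∈ {0,1}^c`, viewed as an element of
`{0,1}^n` (the first `n−c` bits are `x`). -/
def padZ {n c : ℕ} (h : c ≤ n) (x : Fin (n - c) → Bool) (z : Fin c → Bool) : Fin n → Bool :=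
  fun i => Fin.append x z (Fin.cast (Nat.sub_add_cancel h).symm i)

/-- `s_{[1,n−c]}`: the first `n−c` bits of `s ∈ {0,1}^n`. -/
def firstBits {n : ℕ} (c : ℕ) (s : Fin n → Bool) : Fin (n - c) → Bool :=
  fun i => s (Fin.castLE (Nat.sub_le n c) i)

/-- The one-round sponge function `f_π(x) = π(x‖0^c)_{[1,n−c]}` with capacity `c`. -/
def sponge {n c : ℕ} (h : c ≤ n) (π : Equiv.Perm (Fin n → Bool))
    (x : Fin (n - c) → Bool) : Fin (n - c) → Bool :=
  firstBits c (π (padZ h x fun _ => false))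

/-- `Pr_π[x]`: the probability that the algorithm outputs the bit string
`x ∈ {0,1}^{n−c}` (the first `n−c` bits of the measured `X` register):
`∑_{w} ∑_{x″ ∈ {0,1}^c} ∑_{y′} |⟨w, x‖x″, y′|ψ_π⟩|²`. -/
noncomputable def outProbPrefix {n c q' : ℕ} (h : c ≤ n) (A : QueryAlg n q')
    (π : Equiv.Perm (Fin n → Bool)) (x : Fin (n - c) → Bool) : ℝ :=
  ∑ w : A.W, ∑ z : Fin c → Bool, ∑ y : Fin n → Bool,
    ‖finalState A π (w, padZ h x z, y)‖ ^ 2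

section EuclideanNorm

variable {ι : Type*} [Fintype ι]

/-- The Euclidean norm of a complex-valued function on a finite type. -/
noncomputable def nrm (v : ι → ℂ) : ℝ := ‖WithLp.toLp 2 v‖

theorem nrm_nonneg (v : ι → ℂ) : 0 ≤ nrm v := norm_nonneg _

theorem nrm_sq (v : ι → ℂ) : nrm v ^ 2 = ∑ i, ‖v i‖ ^ 2 := by
  simp [nrm, EuclideanSpace.norm_sq_eq]

theorem nrm_add_le (u v : ι → ℂ) : nrm (u + v) ≤ nrm u + nrm v := by
  simpa [nrm] using norm_add_le (WithLp.toLp 2 u) (WithLp.toLp 2 v)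

theorem nrm_eq_of_sum_eq {κ : Type*} [Fintype κ] {u : ι → ℂ} {v : κ → ℂ}
    (h : ∑ i, ‖u i‖ ^ 2 = ∑ i, ‖v i‖ ^ 2) : nrm u = nrm v := by
  rw [← nrm_sq, ← nrm_sq] at h
  exact (pow_left_inj₀ (nrm_nonneg u) (nrm_nonneg v) two_ne_zero).1 h

theorem nrm_unitary_mulVec [DecidableEq ι] {U : Matrix ι ι ℂ} (hU : U ∈ Matrix.unitaryGroup ι ℂ)
    (v : ι → ℂ) : nrm (U.mulVec v) = nrm v := by
  have key : ∀ w : ι → ℂ, ((∑ i, ‖w i‖ ^ 2 : ℝ) : ℂ) = star w ⬝ᵥ w := by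
    intro w
    simp [dotProduct, ← Complex.conj_mul']
  apply nrm_eq_of_sum_eq
  apply Complex.ofReal_injective
  rw [key, key, Matrix.star_mulVec, Matrix.dotProduct_mulVec, Matrix.vecMul_vecMul,
    ← Matrix.star_eq_conjTranspose, Matrix.mem_unitaryGroup_iff'.1 hU, Matrix.vecMul_one]

theorem norm_sq_le_two_mul_add (u v : ℂ) : ‖u‖ ^ 2 ≤ 2 * ‖v‖ ^ 2 + 2 * ‖u - v‖ ^ 2 := by
  have h : ‖u‖ ≤ ‖v‖ + ‖u - v‖ := by simpa using norm_add_le v (u - v)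
  nlinarith [norm_nonneg u, norm_nonneg v, norm_nonneg (u - v), sq_nonneg (‖v‖ - ‖u - v‖)]

theorem norm_sub_sq_le_two_mul_add (u v : ℂ) : ‖u - v‖ ^ 2 ≤ 2 * ‖u‖ ^ 2 + 2 * ‖v‖ ^ 2 := by
  have h := norm_sub_le u v
  nlinarith [norm_nonneg u, norm_nonneg v, norm_nonneg (u - v), sq_nonneg (‖u‖ - ‖v‖)]

/-- The result of applying `f 0, …, f (k - 1)` in turn to `v`. -/
noncomputable def iterState (f : ℕ → Matrix ι ι ℂ) (v : ι → ℂ) : ℕ → ι → ℂ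
  | 0 => v
  | k + 1 => (f k).mulVec (iterState f v k)

theorem reverse_prod_mulVec [DecidableEq ι] (f : ℕ → Matrix ι ι ℂ) (v : ι → ℂ) (k : ℕ) :
    ((List.ofFn fun j : Fin k => f j).reverse.prod).mulVec v = iterState f v k := by
  induction k with
  | zero => simp [iterState]
  | succ k ih =>
    rw [List.ofFn_succ', List.concat_eq_append, List.reverse_append]
    simp only [List.reverse_singleton, List.singleton_append, List.prod_cons, Fin.val_last,
      Fin.val_castSucc, iterState, ← ih, Matrix.mulVec_mulVec]

theorem nrm_iterState {f : ℕ → Matrix ι ι ℂ} (hf : ∀ j v, nrm ((f j).mulVec v) = nrm v)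
    (v : ι → ℂ) (k : ℕ) : nrm (iterState f v k) = nrm v := by
  induction k with
  | zero => rfl
  | succ k ih => rw [iterState, hf, ih]

/-- The hybrid argument. -/
theorem nrm_iterState_sub_le {f g : ℕ → Matrix ι ι ℂ}
    (hg : ∀ j v, nrm ((g j).mulVec v) = nrm v) (v : ι → ℂ) (k : ℕ) :
    nrm (iterState g v k - iterState f v k) ≤
      ∑ j ∈ Finset.range k,
        nrm ((g j).mulVec (iterState f v j) - (f j).mulVec (iterState f v j)) := by
  induction k with
  | zero => simp [iterState, nrm]
  | succ k ih =>
    rw [Finset.sum_range_succ]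
    have h : iterState g v (k + 1) - iterState f v (k + 1) =
        (g k).mulVec (iterState g v k - iterState f v k) +
          ((g k).mulVec (iterState f v k) - (f k).mulVec (iterState f v k)) := by
      simp only [iterState, Matrix.mulVec_sub]
      abel
    rw [h]
    refine (nrm_add_le _ _).trans ?_
    rw [hg]
    gcongr

theorem nrm_iterState_sub_sq_le {f g : ℕ → Matrix ι ι ℂ}
    (hg : ∀ j v, nrm ((g j).mulVec v) = nrm v) (v : ι → ℂ) (k : ℕ) :
    nrm (iterState g v k - iterState f v k) ^ 2 ≤
      k * ∑ j ∈ Finset.range k,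
        nrm ((g j).mulVec (iterState f v j) - (f j).mulVec (iterState f v j)) ^ 2 := by
  refine (pow_le_pow_left₀ (nrm_nonneg _) (nrm_iterState_sub_le hg v k) 2).trans ?_
  simpa using sq_sum_le_card_mul_sum_sq (s := Finset.range k)
    (f := fun j => nrm ((g j).mulVec (iterState f v j) - (f j).mulVec (iterState f v j)))

end EuclideanNorm

section Oracle

variable {m : ℕ} {W : Type*} [Fintype W]

theorem bxor_bxor_cancel (a b : Fin m → Bool) : bxor (bxor a b) b = a := by
  funext i; simp [bxor]

/-- XOR with a fixed bit string, as a permutation. -/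
def bxorEquiv (b : Fin m → Bool) : Equiv.Perm (Fin m → Bool) where
  toFun a := bxor a b
  invFun a := bxor a b
  left_inv a := bxor_bxor_cancel a b
  right_inv a := bxor_bxor_cancel a b

theorem eq_bxor_comm {a b d : Fin m → Bool} : a = bxor b d ↔ b = bxor a d := by
  constructor <;> rintro rfl <;> rw [bxor_bxor_cancel]

theorem kronecker_oracleM_mulVec [DecidableEq W] (π : Equiv.Perm (Fin m → Bool))
    (v : W × (Fin m → Bool) × (Fin m → Bool) → ℂ) (w : W) (x y : Fin m → Bool) :
    (((1 : Matrix W W ℂ) ⊗ₖ oracleM π).mulVec v) (w, x, y) = v (w, x, bxor y (π x)) := by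
  rw [Matrix.mulVec, dotProduct, Finset.sum_eq_single (w, x, bxor y (π x))]
  · simp [oracleM, bxor_bxor_cancel]
  · rintro ⟨w', x', y'⟩ - hne
    have : (1 : Matrix W W ℂ) w w' * oracleM π (x, y) (x', y') = 0 := by
      by_cases hw : w = w'
      · subst hw
        have : ¬ (x = x' ∧ y = bxor y' (π x')) := by
          rintro ⟨rfl, h⟩
          exact hne (by rw [eq_bxor_comm.1 h])
        simp [oracleM, this]
      · simp [Matrix.one_apply_ne hw]
    simp [Matrix.kroneckerMap_apply, this]
  · simp

/-- The probability weight of the value `x` of the first query register in state `v`. -/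
noncomputable def xWeight (v : W × (Fin m → Bool) × (Fin m → Bool) → ℂ) (x : Fin m → Bool) : ℝ :=
  ∑ w, ∑ y, ‖v (w, x, y)‖ ^ 2

theorem xWeight_nonneg (v : W × (Fin m → Bool) × (Fin m → Bool) → ℂ) (x : Fin m → Bool) :
    0 ≤ xWeight v x := by
  unfold xWeight; positivity

theorem sum_xWeight (v : W × (Fin m → Bool) × (Fin m → Bool) → ℂ) :
    ∑ x, xWeight v x = nrm v ^ 2 := by
  simp only [nrm_sq, Fintype.sum_prod_type, xWeight]
  exact Finset.sum_comm

theorem sum_xWeight_comp_le {κ : Type*} [Fintype κ] {e : κ → Fin m → Bool}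
    (he : Function.Injective e) (v : W × (Fin m → Bool) × (Fin m → Bool) → ℂ) :
    ∑ k, xWeight v (e k) ≤ nrm v ^ 2 := by
  rw [← sum_xWeight, ← Finset.sum_image (f := xWeight v) (g := e) (s := Finset.univ)
    (fun _ _ _ _ h => he h)]
  exact Finset.sum_le_sum_of_subset_of_nonneg (Finset.subset_univ _)
    fun x _ _ => xWeight_nonneg v x

theorem sum_norm_sq_bxor {W : Type*} (v : W × (Fin m → Bool) × (Fin m → Bool) → ℂ) (w : W)
    (x b : Fin m → Bool) : ∑ y, ‖v (w, x, bxor y b)‖ ^ 2 = ∑ y, ‖v (w, x, y)‖ ^ 2 :=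
  Equiv.sum_comp (bxorEquiv b) fun y => ‖v (w, x, y)‖ ^ 2

theorem nrm_kronecker_oracleM_mulVec [DecidableEq W] (π : Equiv.Perm (Fin m → Bool))
    (v : W × (Fin m → Bool) × (Fin m → Bool) → ℂ) :
    nrm (((1 : Matrix W W ℂ) ⊗ₖ oracleM π).mulVec v) = nrm v := by
  apply nrm_eq_of_sum_eq
  simp only [Fintype.sum_prod_type, kronecker_oracleM_mulVec, sum_norm_sq_bxor]

/-- Two oracles that agree except possibly at `s` and `t` differ on `v` by at most the weight
of `v` at `s` and `t`. -/
theorem nrm_oracle_sub_sq_le [DecidableEq W] {π ρ : Equiv.Perm (Fin m → Bool)}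
    {s t : Fin m → Bool} (h : ∀ x, x ≠ s → x ≠ t → ρ x = π x)
    (v : W × (Fin m → Bool) × (Fin m → Bool) → ℂ) :
    nrm (((1 : Matrix W W ℂ) ⊗ₖ oracleM ρ).mulVec v - ((1 : Matrix W W ℂ) ⊗ₖ oracleM π).mulVec v)
      ^ 2 ≤ 4 * (xWeight v s + xWeight v t) := by
  have hx : ∀ x, xWeight (((1 : Matrix W W ℂ) ⊗ₖ oracleM ρ).mulVec v -
      ((1 : Matrix W W ℂ) ⊗ₖ oracleM π).mulVec v) x ≤
      (if x = s then 4 * xWeight v s else 0) + (if x = t then 4 * xWeight v t else 0) := by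
    intro x
    have h4 : xWeight (((1 : Matrix W W ℂ) ⊗ₖ oracleM ρ).mulVec v -
        ((1 : Matrix W W ℂ) ⊗ₖ oracleM π).mulVec v) x ≤ 4 * xWeight v x := by
      simp only [xWeight, Pi.sub_apply, kronecker_oracleM_mulVec, Finset.mul_sum (s := .univ (α := W))]
      refine Finset.sum_le_sum fun w _ => ?_
      refine (Finset.sum_le_sum fun y _ => norm_sub_sq_le_two_mul_add _ _).trans ?_
      rw [Finset.sum_add_distrib, ← Finset.mul_sum, ← Finset.mul_sum, sum_norm_sq_bxor,
        sum_norm_sq_bxor]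
      linarith
    have hs := xWeight_nonneg v s
    have ht := xWeight_nonneg v t
    by_cases hxs : x = s
    · subst hxs
      rw [if_pos rfl]
      split_ifs <;> linarith
    · by_cases hxt : x = t
      · subst hxt
        simpa [hxs] using h4
      · simp [hxs, hxt, xWeight, kronecker_oracleM_mulVec, h x hxs hxt]
  rw [← sum_xWeight]
  refine (Finset.sum_le_sum fun x _ => hx x).trans ?_
  simp [Finset.sum_add_distrib, mul_add]

end Oracle

section Reprogramming

/-- The permutation `π` reprogrammed to send `a` to `b`, by exchanging the images of `a` and
`π⁻¹ b`. -/
noncomputable def reprogram {α : Type*} [DecidableEq α] (π : Equiv.Perm α) (a b : α) : Equiv.Perm α :=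
  π * Equiv.swap a (π⁻¹ b)

theorem reprogram_apply_of_ne {α : Type*} [DecidableEq α] {π : Equiv.Perm α} {a b x : α} (ha : x ≠ a)
    (hb : x ≠ π⁻¹ b) : reprogram π a b x = π x := by
  simp only [reprogram, Equiv.Perm.mul_apply]
  rw [Equiv.swap_apply_of_ne_of_ne ha hb]

theorem reprogram_inv_apply_of_ne {α : Type*} [DecidableEq α] {π : Equiv.Perm α} {a b x : α} (ha : x ≠ π a)
    (hb : x ≠ b) : (reprogram π a b)⁻¹ x = π⁻¹ x := by
  simp only [reprogram, mul_inv_rev, Equiv.swap_inv, Equiv.Perm.mul_apply]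
  apply Equiv.swap_apply_of_ne_of_ne
  · exact fun h => ha (by rw [← h]; simp)
  · exact fun h => hb (π⁻¹.injective h)

theorem sum_reprogram {α : Type*} [Fintype α] [DecidableEq α] (a b : α)
    (g : Equiv.Perm α → ℝ) :
    ∑ π : Equiv.Perm α, g (reprogram π a b) =
      Fintype.card α * ∑ π : Equiv.Perm α, if π a = b then g π else 0 := by
  have h1 : ∀ π : Equiv.Perm α, g (reprogram π a b) =
      ∑ a' : α, if π a' = b then g (π * Equiv.swap a a') else 0 := by
    intro π
    rw [Finset.sum_eq_single (π⁻¹ b)]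
    · simp [reprogram]
    · intro a' _ hne
      rw [if_neg]
      rintro rfl
      exact hne (by simp)
    · simp
  simp_rw [h1]
  rw [Finset.sum_comm]
  have h2 : ∀ a' : α, (∑ π : Equiv.Perm α, if π a' = b then g (π * Equiv.swap a a') else 0) =
      ∑ π : Equiv.Perm α, if π a = b then g π else 0 := by
    intro a'
    rw [← Equiv.sum_comp (Equiv.mulRight (Equiv.swap a a'))
      (fun π : Equiv.Perm α => if π a = b then g π else 0)]
    simp
  simp [h2]

end Reprogramming

section Padding

variable {n c : ℕ} (h : c ≤ n)

theorem firstBits_padZ (x : Fin (n - c) → Bool) (z : Fin c → Bool) :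
    firstBits c (padZ h x z) = x := by
  funext i
  exact Fin.append_left x z i

theorem padZ_right_injective (x : Fin (n - c) → Bool) : Function.Injective (padZ h x) := by
  intro z z' hz
  funext i
  have := congrFun hz (Fin.cast (Nat.sub_add_cancel h) (Fin.natAdd (n - c) i))
  simpa [padZ] using this

theorem padZ_left_injective (z : Fin c → Bool) :
    Function.Injective fun x : Fin (n - c) → Bool => padZ h x z := by
  intro x x' hx
  rw [← firstBits_padZ h x z, ← firstBits_padZ h x' z]
  exact congrArg _ hx

theorem padZ_injective :
    Function.Injective fun p : (Fin (n - c) → Bool) × (Fin c → Bool) => padZ h p.1 p.2 := by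
  rintro ⟨x, z⟩ ⟨x', z'⟩ hp
  have hx : x = x' := by
    rw [← firstBits_padZ h x z, ← firstBits_padZ h x' z']
    exact congrArg _ hp
  subst hx
  exact congrArg _ (padZ_right_injective h x hp)

theorem exists_padZ_of_firstBits_eq {s : Fin n → Bool} {x : Fin (n - c) → Bool}
    (hs : firstBits c s = x) : ∃ z, s = padZ h x z := by
  subst hs
  refine ⟨fun i => s (Fin.cast (Nat.sub_add_cancel h) (Fin.natAdd (n - c) i)), ?_⟩
  funext i
  obtain ⟨j, rfl⟩ := (finCongr (Nat.sub_add_cancel h)).surjective i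
  refine Fin.addCases (fun k => ?_) (fun k => ?_) j
  · simp [padZ, firstBits]
    rfl
  · simp [padZ]

theorem sum_ite_eq_padZ (s : Fin n → Bool) (x : Fin (n - c) → Bool) (r : ℝ) :
    (∑ z, if s = padZ h x z then r else 0) = if firstBits c s = x then r else 0 := by
  split_ifs with hs
  · obtain ⟨z, rfl⟩ := exists_padZ_of_firstBits_eq h hs
    rw [Finset.sum_eq_single z]
    · simp
    · intro z' _ hne
      exact if_neg fun e => hne (padZ_right_injective h x e).symm
    · simp
  · refine Finset.sum_eq_zero fun z _ => if_neg ?_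
    rintro rfl
    exact hs (firstBits_padZ h x z)

end Padding

section Algorithm

variable {m q' : ℕ} (A : QueryAlg m q')

namespace QueryAlg

/-- The oracle permutation used in the `j`-th query. -/
def queryPerm (π : Equiv.Perm (Fin m → Bool)) (j : Fin q') : Equiv.Perm (Fin m → Bool) :=
  if A.fwd j then π else π⁻¹

/-- The `j`-th step of the algorithm: a query followed by an oracle-independent unitary. -/
noncomputable def step (π : Equiv.Perm (Fin m → Bool)) (j : ℕ) :
    Matrix (A.W × (Fin m → Bool) × (Fin m → Bool)) (A.W × (Fin m → Bool) × (Fin m → Bool)) ℂ :=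
  if hj : j < q' then
    A.U (Fin.succ ⟨j, hj⟩) * ((1 : Matrix A.W A.W ℂ) ⊗ₖ oracleM (A.queryPerm π ⟨j, hj⟩))
  else 1

/-- The state before the first query. -/
noncomputable def initState : A.W × (Fin m → Bool) × (Fin m → Bool) → ℂ :=
  (A.U 0).mulVec fun p => if p = (A.w0, fun _ => false, fun _ => false) then 1 else 0

theorem finalState_eq (π : Equiv.Perm (Fin m → Bool)) :
    finalState A π = iterState (A.step π) A.initState q' := by
  rw [← reverse_prod_mulVec, initState, Matrix.mulVec_mulVec]
  simp only [finalState, step, queryPerm, Fin.is_lt, dite_true]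

theorem nrm_initState : nrm A.initState = 1 := by
  have h : nrm A.initState ^ 2 = 1 := by
    rw [initState, nrm_unitary_mulVec (by convert A.unitary 0), nrm_sq,
      Finset.sum_eq_single (A.w0, fun _ => false, fun _ => false)]
    · simp
    · intro p _ hp
      simp [hp]
    · simp
  exact (pow_eq_one_iff_of_nonneg (nrm_nonneg _) two_ne_zero).1 h

theorem nrm_step_mulVec (π : Equiv.Perm (Fin m → Bool)) (j : ℕ)
    (v : A.W × (Fin m → Bool) × (Fin m → Bool) → ℂ) :
    nrm ((A.step π j).mulVec v) = nrm v := by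
  unfold step
  split_ifs with hj
  · rw [← Matrix.mulVec_mulVec, nrm_unitary_mulVec (by convert A.unitary _),
      nrm_kronecker_oracleM_mulVec]
  · rw [Matrix.one_mulVec]

theorem nrm_finalState (π : Equiv.Perm (Fin m → Bool)) : nrm (finalState A π) = 1 := by
  rw [finalState_eq, nrm_iterState (A.nrm_step_mulVec π), nrm_initState]

/-- Averaged over the reprogrammed pair, a single query sees little of the change. -/
theorem sum_nrm_step_sub_sq_le {κ μ : Type*} [Fintype κ] [Fintype μ] {e : κ → Fin m → Bool}
    {d : μ → Fin m → Bool} (he : Function.Injective e) (hd : Function.Injective d)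
    (π : Equiv.Perm (Fin m → Bool)) {j : ℕ} (hj : j < q')
    {v : A.W × (Fin m → Bool) × (Fin m → Bool) → ℂ} (hv : nrm v = 1) :
    ∑ k, ∑ l, nrm ((A.step (reprogram π (e k) (d l)) j).mulVec v - (A.step π j).mulVec v) ^ 2 ≤
      4 * ((Fintype.card κ : ℝ) + Fintype.card μ) := by
  have hstep : ∀ ρ, nrm ((A.step ρ j).mulVec v - (A.step π j).mulVec v) =
      nrm (((1 : Matrix A.W A.W ℂ) ⊗ₖ oracleM (A.queryPerm ρ ⟨j, hj⟩)).mulVec v -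
        ((1 : Matrix A.W A.W ℂ) ⊗ₖ oracleM (A.queryPerm π ⟨j, hj⟩)).mulVec v) := by
    intro ρ
    simp only [step, hj, dite_true]
    rw [← Matrix.mulVec_mulVec, ← Matrix.mulVec_mulVec, ← Matrix.mulVec_sub,
      nrm_unitary_mulVec (by convert A.unitary _)]
  have total : ∀ (s : κ → Fin m → Bool) (t : μ → Fin m → Bool), Function.Injective s →
      Function.Injective t → (∀ k l x, x ≠ s k → x ≠ t l →
        A.queryPerm (reprogram π (e k) (d l)) ⟨j, hj⟩ x = A.queryPerm π ⟨j, hj⟩ x) →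
      ∑ k, ∑ l, nrm ((A.step (reprogram π (e k) (d l)) j).mulVec v - (A.step π j).mulVec v) ^ 2
        ≤ 4 * ((Fintype.card κ : ℝ) + Fintype.card μ) := by
    intro s t hs ht hst
    have h1 := sum_xWeight_comp_le hs v
    have h2 := sum_xWeight_comp_le ht v
    rw [hv] at h1 h2
    calc _ ≤ ∑ k, ∑ l, 4 * (xWeight v (s k) + xWeight v (t l)) := by
          refine Finset.sum_le_sum fun k _ => Finset.sum_le_sum fun l _ => ?_
          rw [hstep]
          exact nrm_oracle_sub_sq_le (hst k l) v
      _ = 4 * (Fintype.card μ * ∑ k, xWeight v (s k) +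
            Fintype.card κ * ∑ l, xWeight v (t l)) := by
          simp [← Finset.mul_sum, Finset.sum_add_distrib]
      _ ≤ 4 * (Fintype.card μ * 1 ^ 2 + Fintype.card κ * 1 ^ 2) := by gcongr
      _ = _ := by ring
  by_cases hf : A.fwd ⟨j, hj⟩
  · refine total e (fun l => π⁻¹ (d l)) he (π⁻¹.injective.comp hd) fun k l x hs ht => ?_
    simpa [queryPerm, hf] using reprogram_apply_of_ne hs ht
  · refine total (fun k => π (e k)) d (π.injective.comp he) hd fun k l x hs ht => ?_
    simpa [queryPerm, hf] using reprogram_inv_apply_of_ne hs ht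

theorem sum_nrm_finalState_sub_sq_le {κ μ : Type*} [Fintype κ] [Fintype μ]
    {e : κ → Fin m → Bool} {d : μ → Fin m → Bool} (he : Function.Injective e)
    (hd : Function.Injective d) (π : Equiv.Perm (Fin m → Bool)) :
    ∑ k, ∑ l, nrm (finalState A (reprogram π (e k) (d l)) - finalState A π) ^ 2 ≤
      4 * (q' : ℝ) ^ 2 * ((Fintype.card κ : ℝ) + Fintype.card μ) := by
  set ψ := iterState (A.step π) A.initState with hψ
  calc _ ≤ ∑ k, ∑ l, (q' : ℝ) * ∑ j ∈ Finset.range q',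
          nrm ((A.step (reprogram π (e k) (d l)) j).mulVec (ψ j) -
            (A.step π j).mulVec (ψ j)) ^ 2 := by
        refine Finset.sum_le_sum fun k _ => Finset.sum_le_sum fun l _ => ?_
        rw [finalState_eq, finalState_eq]
        exact nrm_iterState_sub_sq_le (A.nrm_step_mulVec _) _ _
    _ = (q' : ℝ) * ∑ j ∈ Finset.range q', ∑ k, ∑ l,
          nrm ((A.step (reprogram π (e k) (d l)) j).mulVec (ψ j) -
            (A.step π j).mulVec (ψ j)) ^ 2 := by
        simp_rw [← Finset.mul_sum]
        congr 1
        conv_rhs => rw [Finset.sum_comm]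
        refine Finset.sum_congr rfl fun k _ => Finset.sum_comm
    _ ≤ (q' : ℝ) * ∑ _j ∈ Finset.range q', 4 * ((Fintype.card κ : ℝ) + Fintype.card μ) := by
        gcongr with j hj
        refine A.sum_nrm_step_sub_sq_le he hd π (Finset.mem_range.1 hj) ?_
        rw [hψ, nrm_iterState (A.nrm_step_mulVec π), nrm_initState]
    _ = _ := by
        simp only [Finset.sum_const, Finset.card_range, nsmul_eq_mul]
        ring

end QueryAlg

end Algorithm

section OutputProbability

variable {n c q' : ℕ} (h : c ≤ n) (A : QueryAlg n q')

theorem outProbPrefix_eq (π : Equiv.Perm (Fin n → Bool)) (x : Fin (n - c) → Bool) :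
    outProbPrefix h A π x = ∑ z, xWeight (finalState A π) (padZ h x z) := by
  simp only [outProbPrefix, xWeight]
  exact Finset.sum_comm

theorem sum_outProbPrefix_le_one (π : Equiv.Perm (Fin n → Bool)) :
    ∑ x, outProbPrefix h A π x ≤ 1 := by
  have := sum_xWeight_comp_le (padZ_injective h) (finalState A π)
  simpa [outProbPrefix_eq, Fintype.sum_prod_type, A.nrm_finalState] using this

theorem outProbPrefix_le_add (π ρ : Equiv.Perm (Fin n → Bool)) (x : Fin (n - c) → Bool) :
    outProbPrefix h A ρ x ≤
      2 * outProbPrefix h A π x + 2 * nrm (finalState A ρ - finalState A π) ^ 2 := by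
  have h1 := sum_xWeight_comp_le (padZ_right_injective h x) (finalState A ρ - finalState A π)
  have h2 : outProbPrefix h A ρ x ≤ 2 * outProbPrefix h A π x +
      2 * ∑ z, xWeight (finalState A ρ - finalState A π) (padZ h x z) := by
    simp only [outProbPrefix_eq, xWeight, Finset.mul_sum, ← Finset.sum_add_distrib]
    exact Finset.sum_le_sum fun z _ => Finset.sum_le_sum fun w _ => Finset.sum_le_sum fun y _ =>
      norm_sq_le_two_mul_add _ _
  linarith

/-- The expected success probability, multiplied by `N · N!`, in terms of an independent
permutation reprogrammed to map a uniformly random padded input into the target set. -/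
theorem mul_sum_success_eq (y : Fin (n - c) → Bool) :
    (2 : ℝ) ^ n * ∑ π : Equiv.Perm (Fin n → Bool),
        ∑ x ∈ Finset.univ.filter (fun x : Fin (n - c) → Bool => sponge h π x = y),
          outProbPrefix h A π x =
      ∑ π : Equiv.Perm (Fin n → Bool), ∑ x, ∑ z, outProbPrefix h A
        (reprogram π (padZ h x fun _ => false) (padZ h y z)) x := by
  have h1 : ∀ π : Equiv.Perm (Fin n → Bool),
      (∑ x ∈ Finset.univ.filter (fun x : Fin (n - c) → Bool => sponge h π x = y),
        outProbPrefix h A π x) = ∑ x, ∑ z,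
          if π (padZ h x fun _ => false) = padZ h y z then outProbPrefix h A π x else 0 := by
    intro π
    rw [Finset.sum_filter]
    exact Finset.sum_congr rfl fun x _ => (sum_ite_eq_padZ h _ y _).symm
  simp_rw [h1]
  rw [Finset.sum_comm, Finset.mul_sum, Finset.sum_comm]
  refine Finset.sum_congr rfl fun x _ => ?_
  rw [Finset.sum_comm, Finset.mul_sum, Finset.sum_comm]
  refine Finset.sum_congr rfl fun z _ => ?_
  rw [sum_reprogram _ _ fun π => outProbPrefix h A π x]
  simp

theorem sum_reprogram_outProbPrefix_le (y : Fin (n - c) → Bool)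
    (π : Equiv.Perm (Fin n → Bool)) :
    ∑ x, ∑ z, outProbPrefix h A (reprogram π (padZ h x fun _ => false) (padZ h y z)) x ≤
      2 * 2 ^ c + 8 * (q' : ℝ) ^ 2 * (2 ^ (n - c) + 2 ^ c) := by
  have hd := A.sum_nrm_finalState_sub_sq_le (padZ_left_injective h fun _ => false)
    (padZ_right_injective h y) π
  have hp := sum_outProbPrefix_le_one h A π
  calc _ ≤ ∑ x, ∑ z, (2 * outProbPrefix h A π x + 2 * nrm (finalState A
          (reprogram π (padZ h x fun _ => false) (padZ h y z)) - finalState A π) ^ 2) :=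
        Finset.sum_le_sum fun x _ => Finset.sum_le_sum fun z _ => outProbPrefix_le_add h A _ _ x
    _ = 2 * (2 ^ c * ∑ x, outProbPrefix h A π x) + 2 * ∑ x, ∑ z, nrm (finalState A
          (reprogram π (padZ h x fun _ => false) (padZ h y z)) - finalState A π) ^ 2 := by
        simp only [Finset.sum_add_distrib, ← Finset.mul_sum, Finset.sum_const, Finset.card_univ,
          nsmul_eq_mul]
        simp [Finset.mul_sum]
    _ ≤ 2 * (2 ^ c * 1) + 2 * (4 * (q' : ℝ) ^ 2 *
          ((Fintype.card (Fin (n - c) → Bool) : ℝ) + Fintype.card (Fin c → Bool))) := by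
        gcongr
    _ = _ := by
        simp
        ring

end OutputProbability

/-- One-round sponge.  Let `1 ≤ c < n` and let `y ∈ {0,1}^{n−c}` be a
target.  Any quantum query algorithm making fewer than `q` queries to a random permutation
of `{0,1}^n` and its inverse finds a preimage of `y` under the one-round sponge `f_π` with
average probability at most `914 q³ (n+2)/2^{min(c,n−c)}`. -/
theorem stmt18 {n c : ℕ} (hn : 2 ≤ n) (hc1 : 1 ≤ c) (hcn : c < n)
    (y : Fin (n - c) → Bool) (q q' : ℕ) (hq : 1 ≤ q) (hq' : q' < q) (A : QueryAlg n q') :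
    (∑ π : Equiv.Perm (Fin n → Bool),
        ∑ x ∈ Finset.univ.filter
            (fun x : Fin (n - c) → Bool => sponge hcn.le π x = y),
          outProbPrefix hcn.le A π x) / (((2 ^ n : ℕ).factorial : ℝ))
      ≤ 914 * (q : ℝ) ^ 3 * ((n : ℝ) + 2) / (2 : ℝ) ^ min c (n - c) := by
  have hN : (0 : ℝ) < ((2 ^ n : ℕ).factorial : ℝ) := by positivity
  set S := ∑ π : Equiv.Perm (Fin n → Bool),
    ∑ x ∈ Finset.univ.filter (fun x : Fin (n - c) → Bool => sponge hcn.le π x = y),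
      outProbPrefix hcn.le A π x with hS
  have hsum : (2 : ℝ) ^ n * S ≤ ((2 ^ n : ℕ).factorial : ℝ) *
      (2 * 2 ^ c + 8 * (q' : ℝ) ^ 2 * (2 ^ (n - c) + 2 ^ c)) := by
    rw [hS, mul_sum_success_eq]
    refine (Finset.sum_le_sum fun π _ => sum_reprogram_outProbPrefix_le hcn.le A y π).trans ?_
    apply le_of_eq
    simp [Fintype.card_perm, mul_add]
  set r := min c (n - c) with hr
  have hpow : (2 : ℝ) ^ n = 2 ^ c * 2 ^ (n - c) := by
    rw [← pow_add, Nat.add_sub_cancel' hcn.le]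
  have hc : (2 : ℝ) ^ r * 2 ^ c ≤ 2 ^ n := by
    rw [hpow, mul_comm]
    gcongr
    · norm_num
    · exact min_le_right _ _
  have hnc : (2 : ℝ) ^ r * 2 ^ (n - c) ≤ 2 ^ n := by
    rw [hpow]
    gcongr
    · norm_num
    · exact min_le_left _ _
  have hq1 : (1 : ℝ) ≤ q := by exact_mod_cast hq
  have hqq : (q' : ℝ) ^ 2 ≤ (q : ℝ) ^ 3 := by
    have : (q' : ℝ) ≤ q := by exact_mod_cast hq'.le
    calc (q' : ℝ) ^ 2 ≤ (q : ℝ) ^ 2 := by gcongr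
      _ ≤ (q : ℝ) ^ 3 := pow_le_pow_right₀ hq1 (by norm_num)
  have hfin : 2 + 16 * (q' : ℝ) ^ 2 ≤ 914 * (q : ℝ) ^ 3 * ((n : ℝ) + 2) := by
    have h3 : (1 : ℝ) ≤ (q : ℝ) ^ 3 := one_le_pow₀ hq1
    have h4 : (0 : ℝ) ≤ (q : ℝ) ^ 3 * n := by positivity
    nlinarith
  rw [div_le_div_iff₀ hN (by positivity)]
  have hmul : (2 : ℝ) ^ n * (S * 2 ^ r) ≤
      (2 : ℝ) ^ n * ((2 + 16 * (q' : ℝ) ^ 2) * ((2 ^ n : ℕ).factorial : ℝ)) := by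
    calc (2 : ℝ) ^ n * (S * 2 ^ r) = (2 ^ n * S) * 2 ^ r := by ring
      _ ≤ (((2 ^ n : ℕ).factorial : ℝ) *
          (2 * 2 ^ c + 8 * (q' : ℝ) ^ 2 * (2 ^ (n - c) + 2 ^ c))) * 2 ^ r := by gcongr
      _ = ((2 ^ n : ℕ).factorial : ℝ) * (2 * (2 ^ r * 2 ^ c) +
          8 * (q' : ℝ) ^ 2 * (2 ^ r * 2 ^ (n - c) + 2 ^ r * 2 ^ c)) := by ring
      _ ≤ ((2 ^ n : ℕ).factorial : ℝ) * (2 * 2 ^ n +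
          8 * (q' : ℝ) ^ 2 * (2 ^ n + 2 ^ n)) := by gcongr
      _ = _ := by ring
  exact (le_of_mul_le_mul_left hmul (by positivity)).trans (by gcongr)
end
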